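/- Fix k ∈ ℕ, k ≥ 1 and α ∈ ℝ. The order-one binary function f_α is k-polymatroidal if and only if α = 2^n − 1 for some integer n with 0 ≤ n ≤ k (i.e., α ∈ {0, 1, 3, …, 2^k − 1}). -/

import Mathlib

/-- A binary function on finite ground set `E`: a function `f : 2^E → ℝ` with `f ∅ = 1`.
(The function is defined on all finite sets; only its values on subsets of `E` matter.) -/
structure BinaryFunction (α : Type) [DecidableEq α] where
  E : Finset α
  f : Finset α → ℝ
  empty_one : f ∅ = 1

namespace BinaryFunction

variable {α : Type} [DecidableEq α]

/-- Contraction of a single element: `(f/e)(Y) = f(Y)` on ground set `E ∖ {e}`. -/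
def contract (g : BinaryFunction α) (e : α) : BinaryFunction α :=
  ⟨g.E.erase e, g.f, g.empty_one⟩

/-- Deletion of a single element: `(f∖e)(Y) = (f(Y) + f(Y ∪ {e})) / (1 + f({e}))`
on ground set `E ∖ {e}`; well defined iff `1 + f({e}) ≠ 0` (in which case the
`if` branch below agrees with the formula, since the formula gives `1` at `∅`). -/
noncomputable def delete (g : BinaryFunction α) (e : α) : BinaryFunction α :=
  ⟨g.E.erase e,
   fun Y => if Y = ∅ then 1 else (g.f Y + g.f (Y ∪ {e})) / (1 + g.f {e}),
   by simp⟩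

/-- Contraction of a set: `(f/X)(Y) = f(Y)` on ground set `E ∖ X`. -/
def contractSet (g : BinaryFunction α) (X : Finset α) : BinaryFunction α :=
  ⟨g.E \ X, g.f, g.empty_one⟩

/-- Deletion of a set: `(f∖X)(Y) = (∑_{Z ⊆ X} f(Y ∪ Z)) / (∑_{Z ⊆ X} f(Z))`
on ground set `E ∖ X`; well defined iff `∑_{Z ⊆ X} f(Z) ≠ 0` (in which case the
`if` branch agrees with the formula, since the formula gives `1` at `∅`). -/
noncomputable def deleteSet (g : BinaryFunction α) (X : Finset α) : BinaryFunction α :=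
  ⟨g.E \ X,
   fun Y => if Y = ∅ then 1 else
     (∑ Z ∈ X.powerset, g.f (Y ∪ Z)) / (∑ Z ∈ X.powerset, g.f Z),
   by simp⟩

/-- `IsMinorOf m f`: `m` is obtained from `f` by a sequence of single-element
contractions and deletions, each step being well defined. -/
inductive IsMinorOf : BinaryFunction α → BinaryFunction α → Prop
  | refl (f : BinaryFunction α) : IsMinorOf f f
  | contract {f g : BinaryFunction α} (e : α) (he : e ∈ g.E)
      (h : IsMinorOf g f) : IsMinorOf (g.contract e) f
  | delete {f g : BinaryFunction α} (e : α) (he : e ∈ g.E)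
      (hw : 1 + g.f {e} ≠ 0) (h : IsMinorOf g f) : IsMinorOf (g.delete e) f

/-- `f` is stable: every sequence of single-element contractions and deletions applied
to `f` is well defined at every step, i.e. at every reachable minor `g`, deletion of any
ground-set element is well defined. -/
def Stable (f : BinaryFunction α) : Prop :=
  ∀ g : BinaryFunction α, IsMinorOf g f → ∀ e ∈ g.E, 1 + g.f {e} ≠ 0

/-- Isomorphism of binary functions: a bijection `φ` of ground sets with
`f(X) = f'(φ(X))` for all `X ⊆ E`. -/
def Isomorphic (g g' : BinaryFunction α) : Prop :=
  ∃ φ : α → α, Set.InjOn φ ↑g.E ∧ g.E.image φ = g'.E ∧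
    ∀ X ⊆ g.E, g.f X = g'.f (X.image φ)

/-- `f_α`: the order-one binary function on ground set `{e}` with value `α` on `{e}`. -/
def fAlpha (e : α) (a : ℝ) : BinaryFunction α :=
  ⟨{e}, fun X => if X = ∅ then 1 else a, by simp⟩

/-- The rank function `Qf(X) = log₂((∑_{Y ⊆ E} f(Y)) / (∑_{Y ⊆ E∖X} f(Y)))`. -/
noncomputable def Q (g : BinaryFunction α) (X : Finset α) : ℝ :=
  Real.logb 2 ((∑ Y ∈ g.E.powerset, g.f Y) / (∑ Y ∈ (g.E \ X).powerset, g.f Y))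

/-- `f` is rankable: for every `X ⊆ E` the denominator in `Qf(X)` is nonzero and
the quotient is strictly positive. -/
def Rankable (g : BinaryFunction α) : Prop :=
  ∀ X ⊆ g.E, (∑ Y ∈ (g.E \ X).powerset, g.f Y) ≠ 0 ∧
    0 < (∑ Y ∈ g.E.powerset, g.f Y) / (∑ Y ∈ (g.E \ X).powerset, g.f Y)

/-- `f` is `k`-polymatroidal: rankable, with `Qf` satisfying R0–R3. -/
def Polymatroidal (k : ℕ) (g : BinaryFunction α) : Prop :=
  Rankable g ∧
  (∀ X ⊆ g.E, ∃ n : ℕ, g.Q X = n) ∧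
  (∀ X ⊆ g.E, g.Q X ≤ (k : ℝ) * X.card) ∧
  (∀ X ⊆ g.E, ∀ e ∈ g.E, e ∉ X → g.Q X ≤ g.Q (insert e X)) ∧
  (∀ X ⊆ g.E, ∀ a ∈ g.E, ∀ b ∈ g.E, a ∉ X → b ∉ X → a ≠ b →
    g.Q X + g.Q (insert a (insert b X)) ≤ g.Q (insert a X) + g.Q (insert b X))

/-- `f` is linear: `{0,1}`-valued on subsets of `E`, and closed under symmetric
difference of supports. -/
def Linear (g : BinaryFunction α) : Prop :=
  (∀ X ⊆ g.E, g.f X = 0 ∨ g.f X = 1) ∧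
  (∀ X ⊆ g.E, ∀ Y ⊆ g.E, g.f X = 1 → g.f Y = 1 → g.f (symmDiff X Y) = 1)

/-- The order-two excluded minor `g`: value `1` on sets of size `0,1`, `-1` on size `2`. -/
def gTwo (a b : α) : BinaryFunction α :=
  ⟨{a, b}, fun X => if X.card = 2 then -1 else 1, by simp⟩

/-- The order-four excluded minor `f_{U_{2,4}}`: `1` on sizes `0,3`, `0` on sizes `1,2`,
`-1` on size `4`. -/
def fU24 (a b c d : α) : BinaryFunction α :=
  ⟨{a, b, c, d},
   fun X => if X.card = 0 then 1 else if X.card ≤ 2 then 0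
            else if X.card = 3 then 1 else -1,
   by simp⟩

/-- The order-two excluded minors `f_{α,β,γ}` of the `k`-polymatroidal binary functions. -/
def fABG (a b : α) (p q r : ℕ) : BinaryFunction α :=
  ⟨{a, b},
   fun X =>
     if X = ∅ then 1
     else if X = {a} then 2 ^ (p + r - q + 1) - 1
     else if X = {b} then 2 ^ (r + 1) - 1
     else 2 ^ (p + r + 1) - 2 ^ (r + 1) - 2 ^ (p + r - q + 1) + 1,
   by simp⟩

lemma sum_powerset_fAlpha_E (e : α) (a : ℝ) :
    ∑ Y ∈ (fAlpha e a).E.powerset, (fAlpha e a).f Y = 1 + a := by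
  have h : ({e} : Finset α).powerset = {∅, {e}} := by
    ext X
    simp [Finset.subset_singleton_iff]
  simp only [fAlpha, h]
  rw [Finset.sum_pair (Finset.singleton_ne_empty e).symm]
  simp

lemma sum_powerset_fAlpha_E_sdiff_empty (e : α) (a : ℝ) :
    ∑ Y ∈ ((fAlpha e a).E \ ∅).powerset, (fAlpha e a).f Y = 1 + a := by
  rw [Finset.sdiff_empty, sum_powerset_fAlpha_E]

lemma sum_powerset_fAlpha_E_sdiff_singleton (e : α) (a : ℝ) :
    ∑ Y ∈ ((fAlpha e a).E \ {e}).powerset, (fAlpha e a).f Y = 1 := by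
  simp [fAlpha]

lemma Q_fAlpha_empty (e : α) (a : ℝ) : (fAlpha e a).Q ∅ = 0 := by
  rw [Q, sum_powerset_fAlpha_E_sdiff_empty, sum_powerset_fAlpha_E]
  by_cases h : 1 + a = 0 <;> simp [h]

lemma Q_fAlpha_singleton (e : α) (a : ℝ) : (fAlpha e a).Q {e} = Real.logb 2 (1 + a) := by
  rw [Q, sum_powerset_fAlpha_E_sdiff_singleton, sum_powerset_fAlpha_E, div_one]

lemma forall_subset_fAlpha_E (e : α) (a : ℝ) (p : Finset α → Prop) :
    (∀ X ⊆ (fAlpha e a).E, p X) ↔ p ∅ ∧ p {e} := by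
  simp [fAlpha, Finset.subset_singleton_iff]

lemma rankable_fAlpha_iff (e : α) (a : ℝ) : (fAlpha e a).Rankable ↔ 0 < 1 + a := by
  rw [Rankable, forall_subset_fAlpha_E, sum_powerset_fAlpha_E_sdiff_empty,
    sum_powerset_fAlpha_E_sdiff_singleton, sum_powerset_fAlpha_E]
  refine ⟨fun h => by simpa using h.2.2, fun h => ?_⟩
  simp [h, h.ne']

end BinaryFunction

open BinaryFunction in
/-- For `k ≥ 1`, the order-one binary function `f_α` is `k`-polymatroidal
iff `α = 2^n − 1` for some integer `0 ≤ n ≤ k`. -/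
theorem fAlpha_polymatroidal_iff {α : Type} [DecidableEq α]
    (k : ℕ) (hk : 1 ≤ k) (e : α) (a : ℝ) :
    (fAlpha e a).Polymatroidal k ↔ ∃ n : ℕ, n ≤ k ∧ a = 2 ^ n - 1 := by
  constructor
  · rintro ⟨hrank, hint, hle, -, -⟩
    rw [rankable_fAlpha_iff] at hrank
    rw [forall_subset_fAlpha_E] at hint hle
    obtain ⟨n, hn⟩ := hint.2
    have hk' := hle.2
    rw [hn, Finset.card_singleton, Nat.cast_one, mul_one] at hk'
    refine ⟨n, by exact_mod_cast hk', ?_⟩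
    rw [Q_fAlpha_singleton, Real.logb_eq_iff_rpow_eq two_pos (by norm_num) hrank,
      Real.rpow_natCast] at hn
    linarith
  · rintro ⟨n, hnk, rfl⟩
    have hsum : (1 : ℝ) + (2 ^ n - 1) = 2 ^ n := by ring
    have hQ : (fAlpha e ((2 : ℝ) ^ n - 1)).Q {e} = n := by
      rw [Q_fAlpha_singleton, hsum, Real.logb_pow, Real.logb_self_eq_one one_lt_two, mul_one]
    refine ⟨?_, ?_, ?_, ?_, ?_⟩
    · rw [rankable_fAlpha_iff, hsum]
      positivity
    · rw [forall_subset_fAlpha_E]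
      exact ⟨⟨0, by simp [Q_fAlpha_empty]⟩, n, hQ⟩
    · rw [forall_subset_fAlpha_E, Q_fAlpha_empty, hQ]
      simpa using hnk
    · rw [forall_subset_fAlpha_E]
      refine ⟨fun b hb _ => ?_, fun b hb hbe => absurd hb hbe⟩
      rw [Finset.mem_singleton.1 hb, insert_empty_eq, hQ, Q_fAlpha_empty]
      exact n.cast_nonneg
    · intro X _ b hb c hc _ _ hbc
      exact absurd ((Finset.mem_singleton.1 hb).trans (Finset.mem_singleton.1 hc).symm) hbc
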